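/- Let R be a d-dimensional (d ≥ 2) Cohen-Macaulay equi-codimensional normal domain with canonical module, let End_R(M) be a noncommutative crepant resolution of R, and let N be a finitely generated reflexive R-module. Then there exists a complex 0 → M_{d-2} → ... → M_1 → M_0 → N → 0 with each M_i in add M such that applying Hom_R(M, -) yields an exact sequence 0 → Hom_R(M, M_{d-2}) → ... → Hom_R(M, M_0) → Hom_R(M, N) → 0, which is a projective resolution of Hom_R(M, N) over Λ = End_R(M). -/

import Mathlib

open CategoryTheory IsLocalRing
open scoped Classical

universe u

noncomputable section

/-- The depth of a module over a Noetherian local ring: the supremum of lengths of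
regular sequences contained in the maximal ideal (with `depth 0 = ⊤`). -/
def rdepth (R : Type u) [CommRing R] [IsLocalRing R]
    (M : Type u) [AddCommGroup M] [Module R M] : ℕ∞ :=
  if Subsingleton M then ⊤
  else sSup {n : ℕ∞ | ∃ rs : List R, (∀ r ∈ rs, r ∈ IsLocalRing.maximalIdeal R) ∧
    RingTheory.Sequence.IsRegular M rs ∧ (rs.length : ℕ∞) = n}

/-- Vanishing of `Ext^i` over an arbitrary ring. -/
def extVanish (A : Type u) [Ring A] (i : ℕ) (X Y : ModuleCat.{u} A) : Prop :=
  Subsingleton (((Ext ℤ (ModuleCat.{u} A) i).obj (Opposite.op X)).obj Y)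

/-- Projective dimension, via vanishing of Ext. -/
def projDim (A : Type u) [Ring A] (X : Type u) [AddCommGroup X] [Module A X] : ℕ∞ :=
  sInf {n : ℕ∞ | ∀ i : ℕ, n < (i : ℕ∞) → ∀ Y : ModuleCat.{u} A,
    extVanish A i (ModuleCat.of A X) Y}

/-- Global dimension of a ring, via vanishing of Ext. -/
def globalDim (A : Type u) [Ring A] : ℕ∞ :=
  sInf {n : ℕ∞ | ∀ i : ℕ, n < (i : ℕ∞) → ∀ X Y : ModuleCat.{u} A, extVanish A i X Y}

/-- A Noetherian local ring is Cohen-Macaulay if its depth equals its Krull dimension. -/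
def IsCMLocalRing (R : Type u) [CommRing R] [IsLocalRing R] : Prop :=
  (rdepth R R : WithBot ℕ∞) = ringKrullDim R

/-- A ring is Cohen-Macaulay if all its localizations at primes are Cohen-Macaulay. -/
def IsCMRing (R : Type u) [CommRing R] : Prop :=
  ∀ (p : Ideal R) (hp : p.IsPrime),
    letI := hp
    IsCMLocalRing (Localization.AtPrime p)

/-- A canonical module of a local ring: a maximal Cohen-Macaulay module of finite injective
dimension whose endomorphism ring is `R`. -/
structure IsCanonicalModule (R : Type u) [CommRing R] [IsLocalRing R]
    (w : Type u) [AddCommGroup w] [Module R w] : Prop where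
  finite : Module.Finite R w
  mcm : (rdepth R w : WithBot ℕ∞) = ringKrullDim R
  finInjDim : ∃ n : ℕ, ∀ i : ℕ, n < i → ∀ X : ModuleCat.{u} R,
    extVanish R i X (ModuleCat.of R w)
  endIso : Nonempty (Module.End R w ≃+* R)

/-- A canonical module of a (not necessarily local) ring: a finitely generated module
which localizes to a canonical module at every maximal ideal. -/
def IsGlobalCanonicalModule (R : Type u) [CommRing R]
    (w : Type u) [AddCommGroup w] [Module R w] : Prop :=
  Module.Finite R w ∧
  ∀ (m : Ideal R) (hm : m.IsMaximal),
    letI := hm.isPrime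
    IsCanonicalModule (Localization.AtPrime m) (LocalizedModule m.primeCompl w)

/-- The height of a prime ideal. -/
def primeHeight {R : Type u} [CommRing R] (p : Ideal R) (hp : p.IsPrime) : ℕ∞ :=
  Order.height (⟨p, hp⟩ : PrimeSpectrum R)

/-- All maximal ideals have the same height. -/
def EquiCodimensional (R : Type u) [CommRing R] : Prop :=
  ∀ (m₁ m₂ : Ideal R) (h₁ : m₁.IsMaximal) (h₂ : m₂.IsMaximal),
    primeHeight m₁ h₁.isPrime = primeHeight m₂ h₂.isPrime

/-- A non-singular `R`-order: a module-finite `R`-algebra which is a maximal Cohen-Macaulay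
`R`-module and such that `gl.dim Λ_p = dim R_p` for all primes `p` of `R`. -/
structure IsNonsingularOrder (R : Type u) [CommRing R]
    (L : Type u) [Ring L] [Algebra R L] : Prop where
  finite : Module.Finite R L
  mcm : ∀ (p : Ideal R) (hp : p.IsPrime),
    letI := hp
    (rdepth (Localization.AtPrime p) (LocalizedModule p.primeCompl L) : WithBot ℕ∞)
      = ringKrullDim (Localization.AtPrime p)
  gldim : ∀ (p : Ideal R) (hp : p.IsPrime),
    letI := hp
    (globalDim (LocalizedModule p.primeCompl L) : WithBot ℕ∞)
      = ringKrullDim (Localization.AtPrime p)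

/-- `Hom_R(M,N)` is a left module over `End_R(M)^op` via precomposition.
(The paper's convention `fg = f then g` makes its `End_R(M)` the opposite of Mathlib's.) -/
instance endOpModuleHom {R M N : Type u} [CommRing R] [AddCommGroup M] [Module R M]
    [AddCommGroup N] [Module R N] :
    Module (Module.End R M)ᵐᵒᵖ (M →ₗ[R] N) where
  smul a g := g ∘ₗ a.unop
  one_smul g := LinearMap.ext fun _ => rfl
  mul_smul a b g := LinearMap.ext fun _ => rfl
  smul_zero a := LinearMap.ext fun _ => rfl
  smul_add a g h := LinearMap.ext fun _ => rfl
  add_smul a b g := LinearMap.ext fun x => g.map_add _ _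
  zero_smul g := LinearMap.ext fun x => g.map_zero

/-- A noncommutative crepant resolution: `End_R(M)` for a nonzero finitely generated
reflexive `R`-module `M` such that `End_R(M)` is a non-singular `R`-order. -/
def IsNCCR (R : Type u) [CommRing R] (M : Type u) [AddCommGroup M] [Module R M] : Prop :=
  Nontrivial M ∧ Module.Finite R M ∧ Module.IsReflexive R M ∧
    IsNonsingularOrder R (Module.End R M)ᵐᵒᵖ

/-- `X ∈ add M`: `X` is a direct summand of a finite direct sum of copies of `M`. -/
def InAdd (A : Type u) [Ring A] (M : Type u) [AddCommGroup M] [Module A M]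
    (X : Type u) [AddCommGroup X] [Module A X] : Prop :=
  ∃ (n : ℕ) (s : X →ₗ[A] (Fin n → M)) (r : (Fin n → M) →ₗ[A] X),
    r ∘ₗ s = LinearMap.id

end

open Abelian

theorem subsingleton_ext_of_extVanish {A : Type u} [Ring A] {n : ℕ} {X Y : ModuleCat.{u} A}
    (h : extVanish A (n + 1) X Y) : Subsingleton (Abelian.Ext.{u} X Y (n + 1)) := by
  have P : ProjectiveResolution X := (HasProjectiveResolution.out (Z := X)).some
  have hz : Limits.IsZero ((P.complex.linearYonedaObj ℤ Y).homology (n + 1)) :=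
    .of_iso (@ModuleCat.isZero_of_subsingleton _ _ _ h) (P.isoExt (n + 1) Y).symm
  rw [← HomologicalComplex.exactAt_iff_isZero_homology,
    HomologicalComplex.exactAt_iff' _ n (n + 1) (n + 2) (by simp) (by simp),
    ShortComplex.moduleCat_exact_iff] at hz
  refine subsingleton_of_forall_eq 0 fun e => ?_
  obtain ⟨f, hf, rfl⟩ := P.extMk_surjective e (n + 2) rfl
  rw [P.extMk_eq_zero_iff f _ rfl hf n rfl]
  obtain ⟨g, hg⟩ := hz f hf
  exact ⟨g, hg⟩

theorem hasProjectiveDimensionLT_of_extVanish {A : Type u} [Ring A] {n : ℕ} {X : ModuleCat.{u} A}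
    (h : ∀ Y, extVanish A (n + 1) X Y) : HasProjectiveDimensionLT X (n + 1) :=
  hasProjectiveDimensionLT_of_enoughInjectives.{u} X (n + 1) fun Y =>
    subsingleton_ext_of_extVanish (h Y)

/-- A module of finite projective dimension has projective dimension at most `n` if `x` acts
surjectively on its higher `Ext` groups, for a central `x` satisfying Nakayama's lemma. -/
theorem hasProjectiveDimensionLT_of_smul_surjective {A : Type u} [Ring A] [IsNoetherianRing A]
    {k : Type u} [CommRing k] [Linear k (ModuleCat.{u} A)] (x : k)
    (hx : ∀ Z : ModuleCat.{u} A, Module.Finite A Z → ∀ α : Z ⟶ Z, IsIso (𝟙 Z - x • α))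
    (m n : ℕ) (X : ModuleCat.{u} A) [Module.Finite A X] (hm : HasProjectiveDimensionLT X (m + 1))
    (hdiv : ∀ i, n + 1 ≤ i → ∀ Y, ∀ e : Abelian.Ext.{u} X Y i, ∃ e' : Abelian.Ext.{u} X Y i,
      e = x • e') :
    HasProjectiveDimensionLT X (n + 1) := by
  induction m generalizing n X with
  | zero => exact hasProjectiveDimensionLT_of_ge X 1 (n + 1) (by lia)
  | succ m ih =>
    obtain ⟨r, p, hp⟩ := Module.Finite.exists_fin' A X
    have hS := LinearMap.shortExact_shortComplexKer hp
    set S := p.shortComplexKer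
    have hP : Projective S.X₂ :=
      (IsProjective.iff_projective _).1 (inferInstanceAs (Module.Projective A (Fin r → A)))
    have hfin : Module.Finite A S.X₁ := inferInstanceAs (Module.Finite A (LinearMap.ker p))
    have hK : HasProjectiveDimensionLT S.X₁ ((n - 1) + 1) := by
      refine ih (n - 1) S.X₁ ((hS.hasProjectiveDimensionLT_X₃_iff m hP).1 hm) ?_
      intro i hi Y e
      obtain ⟨e'', he''⟩ := hdiv (i + 1) (by lia) Y (hS.extClass.comp e (add_comm 1 i))
      have h1 : ∀ j, 1 ≤ j → ∀ t : Abelian.Ext.{u} S.X₂ Y j, t = 0 := fun j hj t =>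
        t.eq_zero_of_hasProjectiveDimensionLT 1 hj
      obtain ⟨e', rfl⟩ := Ext.contravariant_sequence_exact₃ hS Y e'' (h1 _ (by lia) _)
        (add_comm 1 i)
      obtain ⟨t, ht⟩ := Ext.contravariant_sequence_exact₁ hS Y (e - x • e') (add_comm 1 i)
        (by rw [sub_eq_add_neg, Ext.comp_add, Ext.comp_neg, Ext.comp_smul, he'', add_neg_cancel])
      rw [h1 i (by lia) t, Ext.comp_zero, eq_comm, sub_eq_zero] at ht
      exact ⟨e', ht⟩
    obtain _ | n := n
    · have : HasProjectiveDimensionLT S.X₁ 1 := hK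
      obtain ⟨e'', he''⟩ := hdiv 1 (by lia) S.X₁ hS.extClass
      obtain ⟨e', rfl⟩ := Ext.contravariant_sequence_exact₃ hS S.X₁ e''
        (Ext.eq_zero_of_hasProjectiveDimensionLT _ 1 le_rfl) (add_zero 1)
      obtain ⟨α, rfl⟩ := (Ext.mk₀_bijective _ _).2 e'
      have hiso : IsIso (𝟙 S.X₁ - x • α) := hx _ hfin α
      have h0 : hS.extClass.comp (Ext.mk₀ (𝟙 S.X₁ - x • α)) (add_zero 1) = 0 := by
        rw [sub_eq_add_neg, Ext.mk₀_add, Ext.mk₀_neg, Ext.mk₀_smul, Ext.comp_add, Ext.comp_neg,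
          Ext.comp_smul, Ext.comp_mk₀_id, ← he'', add_neg_cancel]
      have h1 : hS.extClass = 0 := by
        have := congrArg (fun t => t.comp (Ext.mk₀ (inv (𝟙 S.X₁ - x • α))) (add_zero 1)) h0
        simpa using this
      obtain ⟨s', hs'⟩ := Ext.covariant_sequence_exact₃ X hS (Ext.mk₀ (𝟙 X)) (zero_add 1)
        (by rw [h1, Ext.comp_zero])
      obtain ⟨s, rfl⟩ := (Ext.mk₀_bijective _ _).2 s'
      rw [Ext.mk₀_comp_mk₀, (Ext.mk₀_bijective _ _).1.eq_iff] at hs'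
      exact (Retract.mk s S.g hs' : Retract X S.X₂).hasProjectiveDimensionLT 1
    · exact (hS.hasProjectiveDimensionLT_X₃_iff n hP).2 hK

theorem hasProjectiveDimensionLT_of_shortExact_smul {A : Type u} [Ring A] [IsNoetherianRing A]
    {k : Type u} [CommRing k] [Linear k (ModuleCat.{u} A)] (x : k)
    (hx : ∀ Z : ModuleCat.{u} A, Module.Finite A Z → ∀ α : Z ⟶ Z, IsIso (𝟙 Z - x • α))
    {m n : ℕ} (X : ModuleCat.{u} A) [Module.Finite A X] (hm : HasProjectiveDimensionLT X (m + 1))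
    {Q : ModuleCat.{u} A} (g : X ⟶ Q) (w : (x • 𝟙 X) ≫ g = 0)
    (hS : (ShortComplex.mk _ _ w).ShortExact) (hQ : HasProjectiveDimensionLT Q (n + 2)) :
    HasProjectiveDimensionLT X (n + 1) := by
  refine hasProjectiveDimensionLT_of_smul_surjective x hx m n _ hm fun i hi Y e => ?_
  obtain ⟨e', he'⟩ := Ext.contravariant_sequence_exact₁ hS Y e (add_comm 1 i)
    (Ext.eq_zero_of_hasProjectiveDimensionLT _ (n + 2) (by lia))
  exact ⟨e', by rw [← he', Ext.mk₀_smul, Ext.smul_comp, Ext.mk₀_id_comp]⟩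

/-- The `k`-linear structure on modules over a `k`-algebra. -/
abbrev linearModuleCat (k A : Type u) [CommRing k] [Ring A] [Algebra k A] :
    Linear k (ModuleCat.{u} A) where
  homModule X Y :=
    let : Module k Y := Module.restrictScalars k A Y
    have : IsScalarTower k A Y := IsScalarTower.restrictScalars k A Y
    have : SMulCommClass A k Y := IsScalarTower.to_smulCommClass'
    inferInstance
  smul_comp X Y Z r f g := by
    ext v
    exact map_smul g.hom (algebraMap k A r) (f v)
  comp_smul X Y Z f r g := rfl

section LocalBase

variable {k A : Type u} [CommRing k] [IsLocalRing k] [IsNoetherianRing k] [Ring A] [Algebra k A]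
  [Module.Finite k A]

theorem isIso_id_sub_smul {x : k} (hx : x ∈ maximalIdeal k) (Z : ModuleCat.{u} A)
    [Module.Finite A Z] (α : Z ⟶ Z) :
    let := linearModuleCat k A
    IsIso (𝟙 Z - x • α) := by
  let := linearModuleCat k A
  let : Module k Z := Module.restrictScalars k A Z
  have : IsScalarTower k A Z := IsScalarTower.restrictScalars k A Z
  have : Module.Finite k Z := Module.Finite.trans A Z
  have : IsNoetherianRing A := .of_finite k A
  have happ : ∀ z : Z, (𝟙 Z - x • α) z = z - x • α z := fun z => rfl
  rw [ConcreteCategory.isIso_iff_bijective]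
  have hs : Function.Surjective (𝟙 Z - x • α).hom := by
    let N := LinearMap.range ((𝟙 Z - x • α).hom.restrictScalars k)
    have hN : (⊤ : Submodule k Z) ≤ N := by
      refine Submodule.le_of_le_smul_of_le_jacobson_bot (I := maximalIdeal k)
        (Module.finite_def.1 inferInstance) (IsLocalRing.maximalIdeal_le_jacobson _) ?_
      intro z _
      have : z = (𝟙 Z - x • α) z + x • α z := by rw [happ]; abel
      rw [this]
      exact Submodule.add_mem_sup ⟨z, rfl⟩ (Submodule.smul_mem_smul hx trivial)
    intro z
    exact hN (x := z) trivial
  exact IsNoetherian.bijective_of_surjective_endomorphism _ hs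

theorem hasProjectiveDimensionLT_of_regular {x : k} (hx : x ∈ maximalIdeal k)
    (X Q : Type u) [AddCommGroup X] [Module A X] [Module.Finite A X] [AddCommGroup Q] [Module A Q]
    (hreg : ∀ v : X, algebraMap k A x • v = 0 → v = 0)
    (g : X →ₗ[A] Q) (hg : Function.Surjective g)
    (hgx : ∀ v, g v = 0 ↔ ∃ w, v = algebraMap k A x • w) {m n : ℕ}
    (hm : HasProjectiveDimensionLT (ModuleCat.of A X) (m + 1))
    (hQ : HasProjectiveDimensionLT (ModuleCat.of A Q) (n + 2)) :
    HasProjectiveDimensionLT (ModuleCat.of A X) (n + 1) := by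
  let := linearModuleCat k A
  have : IsNoetherianRing A := .of_finite k A
  have : Module.Finite A (ModuleCat.of A X) := ‹Module.Finite A X›
  refine hasProjectiveDimensionLT_of_shortExact_smul x
    (fun Z _ α => isIso_id_sub_smul hx Z α) (ModuleCat.of A X) hm (ModuleCat.ofHom g) ?_ ?_ hQ
  · ext v
    exact (hgx _).2 ⟨v, rfl⟩
  · refine ModuleCat.shortComplex_shortExact _ ?_ ?_ ?_
    · intro v
      exact (hgx v).trans ⟨fun ⟨w, hw⟩ => ⟨w, hw.symm⟩, fun ⟨w, hw⟩ => ⟨w, hw.symm⟩⟩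
    · exact (injective_iff_map_eq_zero' _).2 fun v => ⟨hreg v, fun h => by rw [h, map_zero]⟩
    · exact hg

theorem hasProjectiveDimensionLT_of_regular_pair {x y : k} (hx : x ∈ maximalIdeal k)
    (hy : y ∈ maximalIdeal k) (X : Type u) [AddCommGroup X] [Module A X] [Module.Finite A X]
    (hxr : ∀ v : X, algebraMap k A x • v = 0 → v = 0)
    (hyr : ∀ v w : X, algebraMap k A y • v = algebraMap k A x • w →
      ∃ t, v = algebraMap k A x • t) {n : ℕ}
    (hA : ∀ Z : ModuleCat.{u} A, HasProjectiveDimensionLT Z (n + 3)) :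
    HasProjectiveDimensionLT (ModuleCat.of A X) (n + 1) := by
  have central : ∀ (r : k) (Z : Type u) [AddCommGroup Z] [Module A Z] (a : A) (z : Z),
      algebraMap k A r • a • z = a • algebraMap k A r • z := fun r Z _ _ a z => by
    rw [smul_smul, smul_smul, Algebra.commutes]
  let mul : ∀ (r : k) (Z : Type u) [AddCommGroup Z] [Module A Z], Z →ₗ[A] Z := fun r Z _ _ =>
    { toFun := fun z => algebraMap k A r • z
      map_add' := smul_add _
      map_smul' := fun a z => central r Z a z }
  have hmul : ∀ (r : k) (Z : Type u) [AddCommGroup Z] [Module A Z] (z : Z),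
      (LinearMap.range (mul r Z)).mkQ z = 0 ↔ ∃ w, z = algebraMap k A r • w := by
    intro r Z _ _ z
    rw [Submodule.mkQ_apply, Submodule.Quotient.mk_eq_zero, LinearMap.mem_range]
    exact ⟨fun ⟨w, hw⟩ => ⟨w, hw.symm⟩, fun ⟨w, hw⟩ => ⟨w, hw.symm⟩⟩
  refine hasProjectiveDimensionLT_of_regular hx X (X ⧸ LinearMap.range (mul x X)) hxr _
    (Submodule.mkQ_surjective _) (hmul x X) (m := n + 2) (hA _) ?_
  refine hasProjectiveDimensionLT_of_regular hy _ (_ ⧸ LinearMap.range (mul y _)) ?_ _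
    (Submodule.mkQ_surjective _) (hmul y _) (m := n + 2) (hA _) (hA _)
  intro v hv
  obtain ⟨v, rfl⟩ := Submodule.mkQ_surjective _ v
  rw [← map_smul, hmul] at hv
  obtain ⟨w, hw⟩ := hv
  exact (hmul x X v).2 (hyr v w hw)

end LocalBase

section Localize

variable {R : Type u} [CommRing R] (S : Submonoid R)
  {L B : Type u} [Ring L] [Algebra R L] [Ring B] [Algebra R B] (φ : L →ₐ[R] B)

/-- The localization of `Z` at `S`, as a module over the localized algebra `B`, has projective
dimension less than `n`. -/
def LocalProjDimLT (Z : Type u) [AddCommGroup Z] [Module L Z] [Module R Z] (n : ℕ) : Prop :=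
  ∃ (W : Type u) (_ : AddCommGroup W) (_ : Module B W) (_ : Module R W) (_ : IsScalarTower R B W)
    (f : Z →ₗ[R] W), IsLocalizedModule S f ∧ (∀ (a : L) (z : Z), f (a • z) = φ a • f z) ∧
      HasProjectiveDimensionLT (ModuleCat.of B W) n

/-- Coordinatewise application of an algebra map. -/
def piLocalization (r : ℕ) : (Fin r → L) →ₗ[R] (Fin r → B) :=
  .pi fun i => φ.toLinearMap ∘ₗ .proj i

theorem piLocalization_apply (r : ℕ) (v : Fin r → L) (i : Fin r) :
    piLocalization φ r v i = φ (v i) := rfl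

theorem piLocalization_smul (r : ℕ) (a : L) (v : Fin r → L) :
    piLocalization φ r (a • v) = φ a • piLocalization φ r v := by
  ext i
  simp [piLocalization_apply]

variable {Z W : Type u} [AddCommGroup Z] [Module L Z] [Module R Z]
  [AddCommGroup W] [Module B W] [Module R W]

/-- The map of free `B`-modules induced by a map out of a free `L`-module. -/
def localizedPresentation {r : ℕ} (π : (Fin r → L) →ₗ[L] Z) (f : Z →ₗ[R] W) :
    (Fin r → B) →ₗ[B] W :=
  Fintype.linearCombination B fun i => f (π (Pi.single i 1))

variable {φ} in
theorem localizedPresentation_piLocalization {r : ℕ} (π : (Fin r → L) →ₗ[L] Z) {f : Z →ₗ[R] W}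
    (hf : ∀ (a : L) (z : Z), f (a • z) = φ a • f z) (v : Fin r → L) :
    localizedPresentation (B := B) π f (piLocalization φ r v) = f (π v) := by
  conv_rhs => rw [pi_eq_sum_univ' v]
  simp only [localizedPresentation, Fintype.linearCombination_apply, map_sum, map_smul, hf,
    piLocalization_apply]

variable [IsScalarTower R B W] [IsLocalizedModule S φ.toLinearMap]

instance (r : ℕ) : IsLocalizedModule S (piLocalization φ r) :=
  inferInstanceAs (IsLocalizedModule S (.pi fun i : Fin r => φ.toLinearMap ∘ₗ .proj i))

variable {φ} in
theorem localizedPresentation_surjective {r : ℕ} {π : (Fin r → L) →ₗ[L] Z}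
    (hπ : Function.Surjective π) {f : Z →ₗ[R] W} [IsLocalizedModule S f]
    (hf : ∀ (a : L) (z : Z), f (a • z) = φ a • f z) :
    Function.Surjective (localizedPresentation (B := B) π f) := by
  intro w
  obtain ⟨⟨z, s⟩, hz⟩ := IsLocalizedModule.surj S f w
  obtain ⟨v, rfl⟩ := hπ z
  refine ⟨IsLocalizedModule.mk' (piLocalization φ r) v s, ?_⟩
  apply IsLocalizedModule.smul_injective f s
  dsimp only at hz ⊢
  rw [hz, Submonoid.smul_def, ← LinearMap.map_smul_of_tower, ← Submonoid.smul_def,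
    IsLocalizedModule.mk'_cancel', localizedPresentation_piLocalization π hf]

variable [IsScalarTower R L Z]

theorem LocalProjDimLT.ker {r : ℕ} {π : (Fin r → L) →ₗ[L] Z} (hπ : Function.Surjective π) {n : ℕ}
    (h : LocalProjDimLT S φ Z (n + 2)) : LocalProjDimLT S φ (LinearMap.ker π) (n + 1) := by
  obtain ⟨W, _, _, _, _, f, hloc, hf, hn⟩ := h
  let ρ := localizedPresentation (B := B) π f
  have hρ : Function.Surjective ρ := localizedPresentation_surjective S hπ hf
  have hρι : ∀ v, ρ (piLocalization φ r v) = f (π v) := localizedPresentation_piLocalization π hf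
  let ι : LinearMap.ker π →ₗ[R] LinearMap.ker ρ :=
    { toFun := fun v => ⟨piLocalization φ r v, by simp [hρι]⟩
      map_add' := fun v w => Subtype.ext (map_add (piLocalization φ r) _ _)
      map_smul' := fun a v => Subtype.ext (map_smul (piLocalization φ r) _ _) }
  refine ⟨LinearMap.ker ρ, _, _, _, inferInstance, ι, ⟨?_, ?_, ?_⟩, ?_, ?_⟩
  · intro s
    rw [Module.End.isUnit_iff]
    have hb := (Module.End.isUnit_iff _).1 (IsLocalizedModule.map_units (piLocalization φ r) s)
    refine ⟨fun v w hvw => Subtype.ext (hb.1 (congrArg Subtype.val hvw)), fun w => ?_⟩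
    obtain ⟨v, hv⟩ := hb.2 w.1
    refine ⟨⟨v, ?_⟩, Subtype.ext hv⟩
    apply IsLocalizedModule.smul_injective f s
    change s.1 • ρ v = s.1 • (0 : W)
    rw [smul_zero, ← LinearMap.map_smul_of_tower]
    change s.1 • v = w.1 at hv
    rw [hv]
    exact w.2
  · intro w
    obtain ⟨⟨v, s⟩, hv⟩ := IsLocalizedModule.surj S (piLocalization φ r) w.1
    have h0 : f (π v) = 0 := by
      rw [← hρι, ← hv]
      change ρ (s.1 • w.1) = 0
      rw [LinearMap.map_smul_of_tower, show ρ w.1 = 0 from w.2, smul_zero]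
    obtain ⟨t, ht⟩ := (IsLocalizedModule.eq_zero_iff S f).1 h0
    refine ⟨⟨⟨t • v, ?_⟩, t * s⟩, Subtype.ext ?_⟩
    · change π (t.1 • v) = 0
      rw [LinearMap.map_smul_of_tower]
      exact ht
    · change (t * s) • w.1 = piLocalization φ r (t.1 • v)
      rw [mul_smul, map_smul]
      exact congrArg (t • ·) hv
  · intro v w hvw
    obtain ⟨c, hc⟩ := IsLocalizedModule.exists_of_eq (S := S) (f := piLocalization φ r)
      (congrArg Subtype.val hvw)
    exact ⟨c, Subtype.ext hc⟩
  · exact fun a v => Subtype.ext (piLocalization_smul φ r a v)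
  · have hP : Projective (LinearMap.shortComplexKer ρ).X₂ :=
      (IsProjective.iff_projective _).1 (inferInstanceAs (Module.Projective B (Fin r → B)))
    exact ((LinearMap.shortExact_shortComplexKer hρ).hasProjectiveDimensionLT_X₃_iff n hP).1 hn

theorem LocalProjDimLT.exists_smul_section [IsNoetherianRing L] {r : ℕ}
    {π : (Fin r → L) →ₗ[L] Z} (hπ : Function.Surjective π) (h : LocalProjDimLT S φ Z 1) :
    ∃ s ∈ S, ∃ σ : Z →ₗ[L] (Fin r → L), ∀ z, π (σ z) = s • z := by
  obtain ⟨W, _, _, _, _, f, hloc, hf, hn⟩ := h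
  let ρ := localizedPresentation (B := B) π f
  have hρ : Function.Surjective ρ := localizedPresentation_surjective S hπ hf
  have hρι : ∀ v, ρ (piLocalization φ r v) = f (π v) := localizedPresentation_piLocalization π hf
  have hW : Module.Projective B W := (IsProjective.iff_projective _).2
    (projective_iff_hasProjectiveDimensionLT_one.2 hn)
  obtain ⟨τ, hτ⟩ := Module.projective_lifting_property ρ LinearMap.id hρ
  have hτ' : ∀ w, ρ (τ w) = w := fun w => LinearMap.congr_fun hτ w
  obtain ⟨s, hs⟩ := IsLocalizedModule.exist_integer_multiples_of_finite S (piLocalization φ r)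
    fun i : Fin r => τ (f (π (Pi.single i 1)))
  choose v hv using hs
  let η : (Fin r → L) →ₗ[L] (Fin r → L) := Fintype.linearCombination L v
  have hη : ∀ u, piLocalization φ r (η u) = s • τ (f (π u)) := by
    intro u
    conv_rhs => rw [pi_eq_sum_univ' u]
    simp only [η, Fintype.linearCombination_apply, map_sum, map_smul, hf, piLocalization_smul, hv,
      Finset.smul_sum]
    exact Finset.sum_congr rfl fun i _ => smul_algebra_smul_comm s.1 (φ (u i)) _
  have hlift : ∃ t : S, ∀ u ∈ LinearMap.ker π, t • η u = 0 := by
    obtain ⟨c, q, hq⟩ := Module.Finite.exists_fin' L (LinearMap.ker π)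
    have hker : ∀ u ∈ LinearMap.ker π, piLocalization φ r (η u) = 0 := fun u hu => by
      rw [hη, LinearMap.mem_ker.1 hu, map_zero, map_zero, smul_zero]
    have h1 := fun i => (IsLocalizedModule.eq_zero_iff S (piLocalization φ r)).1
      (hker _ (q (Pi.single i 1)).2)
    choose t ht using h1
    refine ⟨∏ i, t i, fun u hu => ?_⟩
    obtain ⟨b, hb⟩ := hq ⟨u, hu⟩
    have : u = ∑ i, b i • (q (Pi.single i 1)).1 := by
      have := congrArg Subtype.val hb
      rw [pi_eq_sum_univ' b, map_sum] at this
      simpa using this.symm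
    rw [this, map_sum, Finset.smul_sum]
    refine Finset.sum_eq_zero fun i hi => ?_
    rw [map_smul, ← Finset.prod_erase_mul _ _ hi, mul_smul,
      show t i • b i • η (q (Pi.single i 1)).1 = b i • t i • η (q (Pi.single i 1)).1 from
        (smul_algebra_smul_comm (t i).1 (b i) _).symm, ht, smul_zero, smul_zero]
  obtain ⟨t, ht⟩ := hlift
  let σ' : Z →ₗ[L] (Fin r → L) :=
    (LinearMap.ker π).liftQ (t.1 • η) ht ∘ₗ (π.quotKerEquivOfSurjective hπ).symm.toLinearMap
  have hσ : ∀ u, σ' (π u) = t.1 • η u := fun u => by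
    have : (π.quotKerEquivOfSurjective hπ).symm (π u) = (LinearMap.ker π).mkQ u := by
      rw [LinearEquiv.symm_apply_eq]
      rfl
    change (LinearMap.ker π).liftQ (t.1 • η) ht ((π.quotKerEquivOfSurjective hπ).symm (π u)) = _
    rw [this]
    rfl
  have hfσ : ∀ z, f (π (σ' z)) = f ((t * s) • z) := fun z => by
    obtain ⟨u, rfl⟩ := hπ z
    rw [hσ, ← hρι, map_smul, hη, Submonoid.smul_def s, LinearMap.map_smul_of_tower,
      LinearMap.map_smul_of_tower, hτ', Submonoid.smul_def (t * s), map_smul, Submonoid.coe_mul,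
      mul_smul]
  choose c hc using fun i => IsLocalizedModule.exists_of_eq (S := S) (hfσ (π (Pi.single i 1)))
  have hT : ∀ i, (∏ j, c j) • π (σ' (π (Pi.single i 1))) =
      (∏ j, c j) • (t * s) • π (Pi.single i 1) := fun i => by
    rw [← Finset.prod_erase_mul _ _ (Finset.mem_univ i), mul_smul, mul_smul, hc]
  refine ⟨((∏ j, c j) * (t * s) : S), Subtype.prop _, (∏ j, c j : S).1 • σ', fun z => ?_⟩
  obtain ⟨u, rfl⟩ := hπ z
  have key : ((∏ j, c j : S).1 • (π ∘ₗ σ' ∘ₗ π)) =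
      ((∏ j, c j : S).1 * (t * s : S).1) • π := by
    refine (Pi.basisFun L (Fin r)).ext fun i => ?_
    rw [Pi.basisFun_apply, mul_smul]
    exact hT i
  have := LinearMap.congr_fun key u
  rw [LinearMap.smul_apply, LinearMap.map_smul_of_tower]
  exact this

end Localize

theorem hasProjectiveDimensionLT_of_localProjDimLT {R L : Type u} [CommRing R] [Ring L]
    [Algebra R L] [IsNoetherianRing L] {B : MaximalSpectrum R → Type u} [∀ p, Ring (B p)]
    [∀ p, Algebra R (B p)] (φ : ∀ p, L →ₐ[R] B p)
    [∀ p, IsLocalizedModule p.asIdeal.primeCompl (φ p).toLinearMap] (n : ℕ)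
    (Z : Type u) [AddCommGroup Z] [Module L Z] [Module R Z] [IsScalarTower R L Z]
    [Module.Finite L Z] (h : ∀ p, LocalProjDimLT p.asIdeal.primeCompl (φ p) Z (n + 1)) :
    HasProjectiveDimensionLT (ModuleCat.of L Z) (n + 1) := by
  induction n generalizing Z with
  | zero =>
    obtain ⟨r, π, hπ⟩ := Module.Finite.exists_fin' L Z
    let I : Ideal R :=
      { carrier := {a | ∃ σ : Z →ₗ[L] (Fin r → L), ∀ z, π (σ z) = a • z}
        add_mem' := fun ⟨σ, hσ⟩ ⟨τ, hτ⟩ => ⟨σ + τ, fun z => by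
          rw [LinearMap.add_apply, map_add, hσ, hτ, add_smul]⟩
        zero_mem' := ⟨0, fun z => by simp⟩
        smul_mem' := fun c a ⟨σ, hσ⟩ => ⟨c • σ, fun z => by
          rw [LinearMap.smul_apply, LinearMap.map_smul_of_tower, hσ, smul_assoc]⟩ }
    have hI : I = ⊤ := by
      by_contra hne
      obtain ⟨p, hp, hIp⟩ := I.exists_le_maximal hne
      obtain ⟨s, hs, σ, hσ⟩ := LocalProjDimLT.exists_smul_section _ _ hπ (h ⟨p, hp⟩)
      exact hs (hIp ⟨σ, hσ⟩)
    obtain ⟨σ, hσ⟩ := (I.eq_top_iff_one.1 hI : (1 : R) ∈ I)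
    have : Module.Projective L Z := .of_split σ π (LinearMap.ext fun z => by simp [hσ])
    exact projective_iff_hasProjectiveDimensionLT_one.1 ((IsProjective.iff_projective _).1 this)
  | succ n ih =>
    obtain ⟨r, π, hπ⟩ := Module.Finite.exists_fin' L Z
    have hP : Projective (LinearMap.shortComplexKer π).X₂ :=
      (IsProjective.iff_projective _).1 (inferInstanceAs (Module.Projective L (Fin r → L)))
    exact ((LinearMap.shortExact_shortComplexKer hπ).hasProjectiveDimensionLT_X₃_iff n hP).2
      (ih (LinearMap.ker π) fun p => LocalProjDimLT.ker _ _ hπ (h p))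

section LocalizedAction

variable {R : Type u} [CommRing R] (S : Submonoid R)
  {L B : Type u} [Ring L] [Algebra R L] [Ring B] [Algebra R B] (φ : L →ₐ[R] B)
  [IsLocalizedModule S φ.toLinearMap]
  (Z : Type u) [AddCommGroup Z] [Module L Z] [Module R Z] [IsScalarTower R L Z]

/-- The action of a localized algebra on the localization of a module, as a linear map. -/
noncomputable def localizedActionLinear : B →ₗ[R] Module.End R (LocalizedModule S Z) :=
  IsLocalizedModule.lift S φ.toLinearMap
    (IsLocalizedModule.map S (LocalizedModule.mkLinearMap S Z) (LocalizedModule.mkLinearMap S Z) ∘ₗ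
      (Algebra.lsmul R R Z).toLinearMap) fun s => by
    have hs := (Module.End.isUnit_iff _).1
      (IsLocalizedModule.map_units (LocalizedModule.mkLinearMap S Z) s)
    rw [Module.End.isUnit_iff]
    refine ⟨fun f g hfg => LinearMap.ext fun w => hs.1 (LinearMap.congr_fun hfg w), fun f => ?_⟩
    let e := LinearEquiv.ofBijective _ hs
    refine ⟨e.symm.toLinearMap ∘ₗ f, LinearMap.ext fun w => e.apply_symm_apply (f w)⟩

theorem localizedActionLinear_mk (a : L) (z : Z) :
    localizedActionLinear S φ Z (φ a) (LocalizedModule.mkLinearMap S Z z) =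
      LocalizedModule.mkLinearMap S Z (a • z) := by
  have h : localizedActionLinear S φ Z (φ a) = _ :=
    IsLocalizedModule.lift_apply S φ.toLinearMap _ _ a
  rw [h]
  exact IsLocalizedModule.map_apply S _ _ _ z

/-- The action of a localized algebra on the localization of a module. -/
noncomputable def localizedAction : B →+* Module.End R (LocalizedModule S Z) :=
  { (localizedActionLinear S φ Z).toAddMonoidHom with
    map_one' := by
      refine IsLocalizedModule.linearMap_ext S (LocalizedModule.mkLinearMap S Z)
        (LocalizedModule.mkLinearMap S Z) (LinearMap.ext fun z => ?_)
      have := localizedActionLinear_mk S φ Z 1 z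
      rwa [map_one, one_smul] at this
    map_mul' := fun b c => by
      obtain ⟨⟨a, s⟩, hs⟩ := IsLocalizedModule.surj S φ.toLinearMap b
      obtain ⟨⟨a', t⟩, ht⟩ := IsLocalizedModule.surj S φ.toLinearMap c
      change s.1 • b = φ a at hs
      change t.1 • c = φ a' at ht
      change localizedActionLinear S φ Z (b * c) =
        localizedActionLinear S φ Z b * localizedActionLinear S φ Z c
      have key : localizedActionLinear S φ Z (φ (a * a')) =
          localizedActionLinear S φ Z (φ a) * localizedActionLinear S φ Z (φ a') := by
        refine IsLocalizedModule.linearMap_ext S (LocalizedModule.mkLinearMap S Z)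
          (LocalizedModule.mkLinearMap S Z) (LinearMap.ext fun z => ?_)
        simp only [LinearMap.comp_apply, Module.End.mul_apply, localizedActionLinear_mk, mul_smul]
      rw [map_mul, ← hs, ← ht, smul_mul_smul_comm, map_smul, map_smul, map_smul,
        smul_mul_smul_comm] at key
      refine LinearMap.ext fun w => ?_
      exact IsLocalizedModule.smul_injective (LocalizedModule.mkLinearMap S Z) (s * t)
        (LinearMap.congr_fun key w) }

/-- The standard localization of a module, with any compatible action of the localized algebra,
witnesses `LocalProjDimLT`. -/
theorem localProjDimLT_of_localized (n : ℕ)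
    (h : ∀ (_ : Module B (LocalizedModule S Z)) (_ : IsScalarTower R B (LocalizedModule S Z)),
      (∀ (a : L) (z : Z), LocalizedModule.mkLinearMap S Z (a • z) =
        φ a • LocalizedModule.mkLinearMap S Z z) →
      HasProjectiveDimensionLT (ModuleCat.of B (LocalizedModule S Z)) n) :
    LocalProjDimLT S φ Z n := by
  let _ : Module B (LocalizedModule S Z) := .compHom _ (localizedAction S φ Z)
  have hf : ∀ (a : L) (z : Z), LocalizedModule.mkLinearMap S Z (a • z) =
      φ a • LocalizedModule.mkLinearMap S Z z := fun a z =>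
    (localizedActionLinear_mk S φ Z a z).symm
  have ht : IsScalarTower R B (LocalizedModule S Z) := ⟨fun r b w =>
    LinearMap.congr_fun (map_smul (localizedActionLinear S φ Z) r b) w⟩
  exact ⟨LocalizedModule S Z, _, _, _, ht, _, inferInstance, hf, h _ ht hf⟩

/-- If two elements of the maximal ideal of the localized base form a regular sequence on `Z`, then
the localization of `Z` has projective dimension at most two below the global dimension. -/
theorem localProjDimLT_of_regular_pair [IsNoetherianRing R] [Module.Finite R L] [Module.Finite L Z]
    {k : Type u} [CommRing k] [IsLocalRing k] [Algebra R k] [IsLocalization S k] [Algebra k B]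
    [IsScalarTower R k B]
    {x y : R} (hx : algebraMap R k x ∈ maximalIdeal k) (hy : algebraMap R k y ∈ maximalIdeal k)
    (hxr : ∀ v : Z, x • v = 0 → v = 0)
    (hyr : ∀ v w : Z, y • v = x • w → ∃ t, v = x • t) {n : ℕ}
    (hB : ∀ Y : ModuleCat.{u} B, HasProjectiveDimensionLT Y (n + 3)) :
    LocalProjDimLT S φ Z (n + 1) := by
  refine localProjDimLT_of_localized S φ Z _ fun _ ht hf => ?_
  have : IsNoetherianRing k := IsLocalization.isNoetherianRing S k inferInstance
  have : Module.Finite k B := Module.Finite.of_isLocalizedModule S φ.toLinearMap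
  have hsmul : ∀ (r : R) (w : LocalizedModule S Z),
      algebraMap k B (algebraMap R k r) • w = r • w := fun r w => by
    rw [← IsScalarTower.algebraMap_apply, algebraMap_smul]
  have hinj := fun s : S => IsLocalizedModule.smul_injective (LocalizedModule.mkLinearMap S Z) s
  have : Module.Finite B (LocalizedModule S Z) := by
    obtain ⟨r, π, hπ⟩ := Module.Finite.exists_fin' L Z
    exact .of_surjective _ (localizedPresentation_surjective S hπ hf)
  refine hasProjectiveDimensionLT_of_regular_pair hx hy (LocalizedModule S Z) ?_ ?_ hB
  · intro w hw
    rw [hsmul] at hw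
    obtain ⟨⟨z, s⟩, hs⟩ := IsLocalizedModule.surj S (LocalizedModule.mkLinearMap S Z) w
    have h0 : LocalizedModule.mkLinearMap S Z (x • z) = 0 := by
      rw [map_smul, ← hs, smul_comm, hw, smul_zero]
    obtain ⟨t, ht⟩ := (IsLocalizedModule.eq_zero_iff S (LocalizedModule.mkLinearMap S Z)).1 h0
    rw [smul_comm] at ht
    apply hinj s
    dsimp only at hs ⊢
    rw [hs, smul_zero, IsLocalizedModule.eq_zero_iff S]
    exact ⟨t, hxr _ ht⟩
  · intro v w hvw
    rw [hsmul, hsmul] at hvw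
    obtain ⟨⟨z, s⟩, hs⟩ := IsLocalizedModule.surj S (LocalizedModule.mkLinearMap S Z) v
    obtain ⟨⟨z', s'⟩, hs'⟩ := IsLocalizedModule.surj S (LocalizedModule.mkLinearMap S Z) w
    dsimp only at hs hs'
    have h0 : LocalizedModule.mkLinearMap S Z (y • s' • z) =
        LocalizedModule.mkLinearMap S Z (x • s • z') := by
      simp only [Submonoid.smul_def, map_smul] at hs hs' ⊢
      rw [← hs, ← hs', smul_comm y, smul_comm y, hvw, smul_comm s.1 s'.1, smul_comm x, smul_comm x]
    obtain ⟨c, hc⟩ := IsLocalizedModule.exists_of_eq (S := S) h0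
    obtain ⟨t, ht⟩ := hyr (c • s' • z) (c • s • z') (by rw [smul_comm y, smul_comm x, hc])
    refine ⟨IsLocalizedModule.mk' (LocalizedModule.mkLinearMap S Z) t (c * s' * s), ?_⟩
    rw [hsmul]
    apply hinj (c * s' * s)
    dsimp only
    rw [← smul_comm x, IsLocalizedModule.mk'_cancel', ← map_smul, ← ht, mul_smul, hs, mul_smul]
    simp only [Submonoid.smul_def, map_smul]

end LocalizedAction

theorem extVanish_of_globalDim_eq {A : Type u} [Ring A] {n : ℕ} (h : globalDim A = n) {i : ℕ}
    (hi : n < i) (X Y : ModuleCat.{u} A) : extVanish A i X Y := by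
  have hmem := csInf_mem (s := {n : ℕ∞ | ∀ i : ℕ, n < (i : ℕ∞) → ∀ X Y : ModuleCat.{u} A,
    extVanish A i X Y}) ⟨⊤, fun i hi => absurd hi not_top_lt⟩
  rw [← globalDim, h] at hmem
  exact hmem i (by exact_mod_cast hi) X Y

/-- The localization map of an algebra, as an algebra map. -/
def localizedAlgHom {R : Type u} [CommRing R] (S : Submonoid R) (L : Type u) [Ring L]
    [Algebra R L] : L →ₐ[R] LocalizedModule S L :=
  { LocalizedModule.numeratorRingHom with
    commutes' := fun _ => rfl }

instance {R : Type u} [CommRing R] (S : Submonoid R) (L : Type u) [Ring L]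
    [Algebra R L] : IsLocalizedModule S (localizedAlgHom S L).toLinearMap :=
  inferInstanceAs (IsLocalizedModule S (LocalizedModule.mkLinearMap S L))

theorem IsNonsingularOrder.hasProjectiveDimensionLT {R : Type u} [CommRing R] [IsNoetherianRing R]
    {L : Type u} [Ring L] [Algebra R L] (hL : IsNonsingularOrder R L) {n : ℕ}
    (hdim : ∀ (p : Ideal R) [p.IsMaximal], ringKrullDim (Localization.AtPrime p) = (n + 2 : ℕ))
    (Z : Type u) [AddCommGroup Z] [Module L Z] [Module R Z] [IsScalarTower R L Z]
    [Module.Finite L Z]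
    (hreg : ∀ (p : Ideal R), p.IsMaximal → ∃ x ∈ p, ∃ y ∈ p, (∀ v : Z, x • v = 0 → v = 0) ∧
      ∀ v w : Z, y • v = x • w → ∃ t, v = x • t) :
    HasProjectiveDimensionLT (ModuleCat.of L Z) (n + 1) := by
  have : Module.Finite R L := hL.finite
  have : IsNoetherianRing L := .of_finite R L
  refine hasProjectiveDimensionLT_of_localProjDimLT
    (B := fun p : MaximalSpectrum R => LocalizedModule p.asIdeal.primeCompl L)
    (fun p : MaximalSpectrum R => localizedAlgHom p.asIdeal.primeCompl L) n Z fun p => ?_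
  let _ : Algebra (Localization.AtPrime p.asIdeal) (LocalizedModule p.asIdeal.primeCompl L) :=
    LocalizedModule.algebraOfIsLocalization _
  obtain ⟨x, hx, y, hy, hxr, hyr⟩ := hreg p.asIdeal p.isMaximal
  refine localProjDimLT_of_regular_pair _ _ Z (k := Localization.AtPrime p.asIdeal) (x := x)
    (y := y) ?_ ?_ hxr hyr fun Y => ?_
  · exact (IsLocalization.AtPrime.to_map_mem_maximal_iff _ p.asIdeal x).2 hx
  · exact (IsLocalization.AtPrime.to_map_mem_maximal_iff _ p.asIdeal y).2 hy
  · have hg := hL.gldim p.asIdeal inferInstance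
    rw [hdim] at hg
    exact hasProjectiveDimensionLT_of_extVanish (n := n + 2)
      (extVanish_of_globalDim_eq (n := n + 2) (WithBot.coe_injective hg) (by lia) Y)

theorem EquiCodimensional.height_eq {R : Type u} [CommRing R] (hR : EquiCodimensional R) {d : ℕ}
    (hd : ringKrullDim R = d) (p : Ideal R) [hp : p.IsMaximal] : p.height = d := by
  have : FiniteRingKrullDim R := finiteRingKrullDim_iff_ne_bot_and_top.2
    ⟨by rw [hd]; exact WithBot.coe_ne_bot, by
      rw [hd]
      exact fun h => ENat.natCast_ne_top d (WithBot.coe_injective h)⟩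
  obtain ⟨q, hq, hqd⟩ := Ideal.exists_isMaximal_height (R := R)
  rw [hd] at hqd
  have hpq := hR p q hp hq
  rw [primeHeight, primeHeight, ← PrimeSpectrum.height_eq_orderHeight,
    ← PrimeSpectrum.height_eq_orderHeight] at hpq
  exact hpq.trans (WithBot.coe_injective hqd)

section RegularPair

variable {R : Type u} [CommRing R] [IsNoetherianRing R] [IsDomain R] [IsIntegrallyClosed R]
  {p : Ideal R} [p.IsMaximal]

/-- In a normal domain, primes of height at least two are not associated to principal ideals. -/
theorem dvd_of_forall_mem_dvd_mul (hp : 2 ≤ p.height) {x : R} (hx : x ∈ p) (hx0 : x ≠ 0) {a : R}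
    (ha : ∀ c ∈ p, x ∣ c * a) : x ∣ a := by
  choose u hu using ha
  by_cases hup : ∀ c hc, u c hc ∈ p
  · let K := FractionRing R
    have hinj := IsFractionRing.injective R K
    have hxK : algebraMap R K x ≠ 0 := by simpa using hx0
    let N : Submodule R K := Submodule.map (Algebra.linearMap R K) p
    have hint : IsIntegral R (algebraMap R K a / algebraMap R K x) := by
      refine isIntegral_of_smul_mem_submodule N ?_ ?_ _ ?_
      · rw [Submodule.ne_bot_iff]
        exact ⟨algebraMap R K x, ⟨x, hx, rfl⟩, hxK⟩
      · exact (IsNoetherian.noetherian p).map _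
      · rintro _ ⟨c, hc, rfl⟩
        refine ⟨u c hc, hup c hc, ?_⟩
        rw [Algebra.linearMap_apply, Algebra.linearMap_apply, smul_eq_mul, div_mul_eq_mul_div,
          eq_div_iff hxK, ← map_mul, ← map_mul, mul_comm a, hu c hc, mul_comm]
    obtain ⟨b, hb⟩ := IsIntegrallyClosed.isIntegral_iff.1 hint
    rw [eq_div_iff hxK, ← map_mul] at hb
    exact ⟨b, by rw [← hinj hb, mul_comm]⟩
  · push Not at hup
    obtain ⟨b, hb, hub⟩ := hup
    have hmem : ∀ c ∈ p, b ∣ u b hb * c := fun c hc => by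
      refine ⟨u c hc, mul_left_cancel₀ hx0 ?_⟩
      rw [← mul_assoc, ← hu b hb, mul_left_comm, ← hu c hc]
      ring
    have hmin : p ∈ (Ideal.span {b}).minimalPrimes := by
      refine ⟨⟨inferInstance, (Ideal.span_singleton_le_iff_mem _).2 hb⟩,
        fun q ⟨hq, hbq⟩ hqp c hc => ?_⟩
      have : u b hb * c ∈ q := hbq (Ideal.mem_span_singleton.2 (hmem c hc))
      exact (hq.mem_or_mem this).resolve_left fun h => hub (hqp h)
    have := hp.trans (Ideal.height_le_one_of_isPrincipal_of_mem_minimalPrimes _ _ hmin)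
    exact absurd this (by decide)

theorem exists_regular_pair (hp : 2 ≤ p.height) :
    ∃ x ∈ p, ∃ y ∈ p, x ≠ 0 ∧ ∀ a b, y * a = x * b → x ∣ a := by
  obtain ⟨x, hx, hx0⟩ : ∃ x ∈ p, x ≠ 0 := by
    rw [← Submodule.ne_bot_iff]
    rintro rfl
    rw [Ideal.height_bot] at hp
    exact absurd hp (by decide)
  have hsub : Subsingleton ((R ⧸ p) →ₗ[R] (R ⧸ Ideal.span {x})) := by
    refine subsingleton_of_forall_eq 0 fun f => ?_
    obtain ⟨a, ha⟩ := Ideal.Quotient.mk_surjective (f 1)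
    have hfa : ∀ c : R, f (Ideal.Quotient.mk p c) = Ideal.Quotient.mk _ (c * a) := fun c => by
      have : Ideal.Quotient.mk p c = c • 1 := by rw [Algebra.smul_def, mul_one]; rfl
      rw [this, map_smul, ← ha, Algebra.smul_def, map_mul]
      rfl
    have hxa : x ∣ a := dvd_of_forall_mem_dvd_mul hp hx hx0 fun c hc => by
      rw [← Ideal.mem_span_singleton, ← Ideal.Quotient.eq_zero_iff_mem, ← hfa,
        Ideal.Quotient.eq_zero_iff_mem.2 hc, map_zero]
    ext
    change f (Ideal.Quotient.mk p 1) = 0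
    rw [hfa, one_mul, Ideal.Quotient.eq_zero_iff_mem, Ideal.mem_span_singleton]
    exact hxa
  obtain ⟨y, hy, hreg⟩ := IsSMulRegular.subsingleton_linearMap_iff.1 hsub
  rw [Ideal.annihilator_quotient] at hy
  refine ⟨x, hx, y, hy, hx0, fun a b hab => ?_⟩
  rw [← Ideal.mem_span_singleton, ← Ideal.Quotient.eq_zero_iff_mem]
  apply hreg
  change y • Ideal.Quotient.mk _ a = y • 0
  rw [smul_zero, Algebra.smul_def, Ideal.Quotient.algebraMap_eq, ← map_mul,
    Ideal.Quotient.eq_zero_iff_mem, Ideal.mem_span_singleton]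
  exact ⟨b, hab⟩

end RegularPair

section Reflexive

variable {R : Type u} [CommRing R] [IsDomain R] {N : Type u} [AddCommGroup N] [Module R N]
  [Module.IsReflexive R N] {x y : R}

theorem eq_zero_of_smul_eq_zero_of_isReflexive (hx : x ≠ 0) {v : N} (hv : x • v = 0) : v = 0 := by
  apply (Module.bijective_dual_eval R N).1
  ext f
  have : x * f v = 0 := by rw [← smul_eq_mul, ← map_smul, hv, map_zero]
  simpa [hx] using this

theorem exists_eq_smul_of_isReflexive (hx : x ≠ 0) (hxy : ∀ a b, y * a = x * b → x ∣ a) {v w : N}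
    (hvw : y • v = x • w) : ∃ t, v = x • t := by
  have hdvd : ∀ f : Module.Dual R N, x ∣ f v := fun f => hxy _ (f w) (by
    rw [← smul_eq_mul, ← map_smul, hvw, map_smul, smul_eq_mul])
  choose q hq using hdvd
  let F : Module.Dual R (Module.Dual R N) :=
    { toFun := q
      map_add' := fun f g => mul_left_cancel₀ hx (by rw [mul_add, ← hq, ← hq, ← hq]; rfl)
      map_smul' := fun r f => mul_left_cancel₀ hx (by
        rw [smul_eq_mul, RingHom.id_apply, mul_left_comm, ← hq, ← hq]; rfl) }
  obtain ⟨t, ht⟩ := (Module.bijective_dual_eval R N).2 F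
  refine ⟨t, (Module.bijective_dual_eval R N).1 (LinearMap.ext fun f => ?_)⟩
  have := LinearMap.congr_fun ht f
  rw [Module.Dual.eval_apply] at this ⊢
  rw [Module.Dual.eval_apply, map_smul, this, hq]
  rfl

theorem exists_eq_smul_linearMap_of_isReflexive {M : Type u} [AddCommGroup M] [Module R M]
    (hx : x ≠ 0) (hxy : ∀ a b, y * a = x * b → x ∣ a) {f g : M →ₗ[R] N} (hfg : y • f = x • g) :
    ∃ h : M →ₗ[R] N, f = x • h := by
  have hinj : ∀ {v w : N}, x • v = x • w → v = w := fun h =>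
    sub_eq_zero.1 (eq_zero_of_smul_eq_zero_of_isReflexive hx (by rw [smul_sub, h, sub_self]))
  choose h hh using fun m => exists_eq_smul_of_isReflexive hx hxy (LinearMap.congr_fun hfg m)
  refine ⟨{ toFun := h, map_add' := fun a b => hinj ?_, map_smul' := fun r a => hinj ?_ },
    LinearMap.ext hh⟩
  · rw [smul_add, ← hh, ← hh, ← hh, map_add]
  · rw [RingHom.id_apply, smul_comm, ← hh, ← hh, map_smul]

end Reflexive

section Projectivization

variable {R M X Y : Type u} [CommRing R] [AddCommGroup M] [Module R M] [AddCommGroup X]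
  [Module R X] [AddCommGroup Y] [Module R Y]

instance : IsScalarTower R (Module.End R M)ᵐᵒᵖ (M →ₗ[R] X) :=
  ⟨fun r a g => LinearMap.ext fun m => map_smul g r (a.unop m)⟩

variable (M) in
/-- Postcomposition, as a linear map over the endomorphism ring of `M`. -/
def homPostcomp (f : X →ₗ[R] Y) : (M →ₗ[R] X) →ₗ[(Module.End R M)ᵐᵒᵖ] (M →ₗ[R] Y) where
  toFun h := f ∘ₗ h
  map_add' _ _ := LinearMap.comp_add _ _ _
  map_smul' _ _ := rfl

theorem homPostcomp_apply (f : X →ₗ[R] Y) (h : M →ₗ[R] X) : homPostcomp M f h = f ∘ₗ h := rfl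

variable (R M) in
/-- Maps from `M` to a finite power of `M` form a free module over the endomorphism ring. -/
def endPowEquivHom (n : ℕ) :
    (Fin n → (Module.End R M)ᵐᵒᵖ) ≃ₗ[(Module.End R M)ᵐᵒᵖ] (M →ₗ[R] (Fin n → M)) where
  toFun v := LinearMap.pi fun i => (v i).unop
  map_add' _ _ := rfl
  map_smul' _ _ := rfl
  invFun h i := MulOpposite.op (LinearMap.proj i ∘ₗ h)
  left_inv _ := rfl
  right_inv _ := rfl

instance (n : ℕ) : Module.Projective (Module.End R M)ᵐᵒᵖ (M →ₗ[R] (Fin n → M)) :=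
  .of_equiv (endPowEquivHom R M n)

theorem InAdd.projective_hom (h : InAdd R M X) :
    Module.Projective (Module.End R M)ᵐᵒᵖ (M →ₗ[R] X) := by
  obtain ⟨n, s, r, hrs⟩ := h
  refine .of_split (homPostcomp M s) (homPostcomp M r) (LinearMap.ext fun h => ?_)
  rw [LinearMap.comp_apply, homPostcomp_apply, homPostcomp_apply, ← LinearMap.comp_assoc, hrs]
  rfl

theorem inAdd_pi (n : ℕ) : InAdd R M (Fin n → M) :=
  ⟨n, LinearMap.id, LinearMap.id, rfl⟩

theorem inAdd_of_subsingleton [Subsingleton X] : InAdd R M X :=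
  ⟨0, 0, 0, LinearMap.ext fun _ => Subsingleton.elim _ _⟩

theorem homPostcomp_injective_pi {n : ℕ} {f g : (Fin n → M) →ₗ[R] X}
    (h : homPostcomp M f = homPostcomp M g) : f = g :=
  LinearMap.pi_ext' fun i => LinearMap.congr_fun h (LinearMap.single R (fun _ => M) i)

theorem exists_homPostcomp_eq {n : ℕ}
    (θ : (M →ₗ[R] (Fin n → M)) →ₗ[(Module.End R M)ᵐᵒᵖ] (M →ₗ[R] X)) :
    ∃ f : (Fin n → M) →ₗ[R] X, homPostcomp M f = θ := by
  refine ⟨∑ i, θ (LinearMap.single R (fun _ => M) i) ∘ₗ LinearMap.proj i, LinearMap.ext fun h => ?_⟩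
  have hh : h = ∑ i, MulOpposite.op (LinearMap.proj i ∘ₗ h : Module.End R M) •
      LinearMap.single R (fun _ => M) i := by
    ext m j
    simp only [LinearMap.sum_apply, Finset.sum_apply]
    rw [Finset.sum_eq_single j]
    · exact (Pi.single_eq_same (M := fun _ => M) j (h m j)).symm
    · exact fun i _ hij => Pi.single_eq_of_ne (M := fun _ => M) hij.symm (h m i)
    · simp
  conv_rhs => rw [hh, map_sum]
  ext m
  simp only [map_smul, homPostcomp_apply, LinearMap.comp_apply, LinearMap.sum_apply]
  rfl

theorem exists_addApproximation [IsNoetherianRing R] [Module.Finite R M] [Module.Finite R X] :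
    ∃ (n : ℕ) (f : (Fin n → M) →ₗ[R] X), Function.Surjective (homPostcomp M f) := by
  have : Module.Finite (Module.End R M)ᵐᵒᵖ (M →ₗ[R] X) := .of_restrictScalars_finite R _ _
  obtain ⟨n, π, hπ⟩ := Module.Finite.exists_fin' (Module.End R M)ᵐᵒᵖ (M →ₗ[R] X)
  obtain ⟨f, hf⟩ := exists_homPostcomp_eq (π ∘ₗ (endPowEquivHom R M n).symm.toLinearMap)
  refine ⟨n, f, ?_⟩
  rw [hf]
  exact hπ.comp (endPowEquivHom R M n).symm.surjective

/-- A summand of a module of the form `Hom(M, Mⁿ)` is represented by a module in `add M`. -/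
theorem exists_inAdd_bijective {n : ℕ} {f : (Fin n → M) →ₗ[R] X}
    (hf : Function.Surjective (homPostcomp M f))
    [Module.Projective (Module.End R M)ᵐᵒᵖ (M →ₗ[R] X)] :
    ∃ (P : ModuleCat.{u} R) (g : P →ₗ[R] X), InAdd R M P ∧
      Function.Bijective (homPostcomp M g) := by
  obtain ⟨σ, hσ⟩ := Module.projective_lifting_property (homPostcomp M f) LinearMap.id hf
  have hσ' : ∀ h, f ∘ₗ σ h = h := fun h => LinearMap.congr_fun hσ h
  obtain ⟨e, he⟩ := exists_homPostcomp_eq (σ ∘ₗ homPostcomp M f)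
  have he' : ∀ h : M →ₗ[R] (Fin n → M), e ∘ₗ h = σ (f ∘ₗ h) := fun h => LinearMap.congr_fun he h
  have hee : e ∘ₗ e = e := homPostcomp_injective_pi (LinearMap.ext fun h => by
    rw [homPostcomp_apply, homPostcomp_apply, LinearMap.comp_assoc, he', he', hσ'])
  let s := (LinearMap.range e).subtype
  let r := e.rangeRestrict
  have hes : e ∘ₗ s = s := LinearMap.ext fun ⟨_, v, hv⟩ => hv ▸ LinearMap.congr_fun hee v
  have hsr : s ∘ₗ r = e := rfl
  refine ⟨.of R (LinearMap.range e), f ∘ₗ s, ⟨n, s, r, ?_⟩, ?_, ?_⟩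
  · exact LinearMap.ext fun v => Subtype.ext (LinearMap.congr_fun hes v)
  · rw [injective_iff_map_eq_zero]
    intro h hh
    have : s ∘ₗ h = 0 := by
      rw [← hes, LinearMap.comp_assoc, he', ← LinearMap.comp_assoc, ← homPostcomp_apply, hh,
        map_zero]
    exact LinearMap.ext fun m => Subtype.ext (LinearMap.congr_fun this m)
  · refine fun h => ⟨r ∘ₗ σ h, ?_⟩
    change f ∘ₗ (s ∘ₗ r) ∘ₗ σ h = h
    rw [hsr, he', hσ', hσ']

end Projectivization

section Resolution

variable (R M : Type u) [CommRing R] [AddCommGroup M] [Module R M]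

/-- A complex of modules in `add M` of length `k` augmented towards `N`, exact after applying
`Hom(M, -)`. -/
def HasAddResolution (N : Type u) [AddCommGroup N] [Module R N] (k : ℕ) : Prop :=
  ∃ (G : ℕ → ModuleCat.{u} R) (g : ∀ i, ↥(G (i + 1)) →ₗ[R] ↥(G i)) (g0 : ↥(G 0) →ₗ[R] N),
    (∀ i, i ≤ k → InAdd R M (G i)) ∧
    (∀ i, k < i → Subsingleton (G i)) ∧
    (∀ i, (g i) ∘ₗ (g (i + 1)) = 0) ∧ (g0 ∘ₗ g 0 = 0) ∧
    Function.Surjective (fun h : M →ₗ[R] ↥(G 0) => g0 ∘ₗ h) ∧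
    Function.Exact (fun h : M →ₗ[R] ↥(G 1) => (g 0) ∘ₗ h)
      (fun h : M →ₗ[R] ↥(G 0) => g0 ∘ₗ h) ∧
    (∀ i, Function.Exact (fun h : M →ₗ[R] ↥(G (i + 2)) => (g (i + 1)) ∘ₗ h)
      (fun h : M →ₗ[R] ↥(G (i + 1)) => (g i) ∘ₗ h))

variable {R M} {N : Type u} [AddCommGroup N] [Module R N]

theorem hasAddResolution_zero {P : ModuleCat.{u} R} {g : P →ₗ[R] N} (hP : InAdd R M P)
    (hg : Function.Bijective (homPostcomp M g)) : HasAddResolution R M N 0 := by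
  refine ⟨fun | 0 => P | _ + 1 => .of R PUnit, fun | 0 => 0 | _ + 1 => 0, g, ?_, ?_, ?_, ?_, hg.2,
    ?_, ?_⟩
  · rintro (_ | i) hi
    · exact hP
    · exact absurd hi (by lia)
  · rintro (_ | i) hi
    · exact absurd hi (by lia)
    · exact inferInstanceAs (Subsingleton PUnit)
  · rintro (_ | i)
    · exact LinearMap.zero_comp _
    · exact LinearMap.zero_comp _
  · exact LinearMap.comp_zero _
  · refine fun h => ⟨fun hh => ⟨0, ?_⟩, ?_⟩
    · exact ((injective_iff_map_eq_zero (homPostcomp M g)).1 hg.1 h hh).symm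
    · rintro ⟨h, rfl⟩
      exact LinearMap.comp_zero _
  · intro i h
    have hz : h = 0 := LinearMap.ext fun m => Subsingleton.elim (α := PUnit.{u + 1}) (h m) 0
    subst hz
    exact ⟨fun _ => ⟨0, LinearMap.comp_zero _⟩, fun _ => LinearMap.comp_zero _⟩

theorem HasAddResolution.cons {P : Type u} [AddCommGroup P] [Module R P] (hP : InAdd R M P)
    {f : P →ₗ[R] N} (hf : Function.Surjective (homPostcomp M f)) {k : ℕ}
    (h : HasAddResolution R M (LinearMap.ker f) k) : HasAddResolution R M N (k + 1) := by
  obtain ⟨G, g, g0, hG, hG', hg, hg0, hsurj, hex, hexact⟩ := h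
  let ι := (LinearMap.ker f).subtype
  have hι : ∀ h : M →ₗ[R] LinearMap.ker f, ι ∘ₗ h = 0 ↔ h = 0 := fun h =>
    ⟨fun hh => LinearMap.ext fun m => Subtype.ext (LinearMap.congr_fun hh m),
      fun hh => by rw [hh, LinearMap.comp_zero]⟩
  refine ⟨fun | 0 => .of R P | i + 1 => G i, fun | 0 => ι ∘ₗ g0 | i + 1 => g i, f, ?_, ?_, ?_, ?_,
    hf, ?_, ?_⟩
  · rintro (_ | i) hi
    · exact hP
    · exact hG i (by lia)
  · rintro (_ | i) hi
    · exact absurd hi (by lia)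
    · exact hG' i (by lia)
  · rintro (_ | i)
    · change (ι ∘ₗ g0) ∘ₗ g 0 = 0
      rw [LinearMap.comp_assoc, hg0, LinearMap.comp_zero]
    · exact hg i
  · exact LinearMap.ext fun v => (g0 v).2
  · refine fun h => ⟨fun hh => ?_, ?_⟩
    · obtain ⟨h', hh'⟩ := hsurj (h.codRestrict (LinearMap.ker f) fun m => LinearMap.congr_fun hh m)
      exact ⟨h', LinearMap.ext fun m => congrArg Subtype.val (LinearMap.congr_fun hh' m)⟩
    · rintro ⟨h, rfl⟩
      exact LinearMap.ext fun m => (g0 (h m)).2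
  · rintro (_ | i)
    · exact fun h => (hι (g0 ∘ₗ h)).trans (hex h)
    · exact hexact i

theorem hasAddResolution_of_hasProjectiveDimensionLT [IsNoetherianRing R] [Module.Finite R M]
    [Module.Finite R N] {k : ℕ}
    (h : HasProjectiveDimensionLT (ModuleCat.of (Module.End R M)ᵐᵒᵖ (M →ₗ[R] N)) (k + 1)) :
    HasAddResolution R M N k := by
  obtain ⟨n, f, hf⟩ := exists_addApproximation (R := R) (M := M) (X := N)
  induction k generalizing N n with
  | zero =>
    have : Module.Projective (Module.End R M)ᵐᵒᵖ (M →ₗ[R] N) := (IsProjective.iff_projective _).2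
      (projective_iff_hasProjectiveDimensionLT_one.2 h)
    obtain ⟨P, g, hP, hg⟩ := exists_inAdd_bijective hf
    exact hasAddResolution_zero hP hg
  | succ k ih =>
    have hP : Projective (ModuleCat.of (Module.End R M)ᵐᵒᵖ (M →ₗ[R] (Fin n → M))) :=
      (IsProjective.iff_projective _).1 inferInstance
    have hS : (ShortComplex.mk (ModuleCat.ofHom (homPostcomp M (LinearMap.ker f).subtype))
        (ModuleCat.ofHom (homPostcomp M f)) (by ext h m; exact (h m).2)).ShortExact := by
      refine ModuleCat.shortComplex_shortExact _ ?_ ?_ hf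
      · refine fun h => ⟨fun hh => ?_, ?_⟩
        · exact ⟨h.codRestrict (LinearMap.ker f) fun m => LinearMap.congr_fun hh m, rfl⟩
        · rintro ⟨h, rfl⟩
          exact LinearMap.ext fun m => (h m).2
      · exact fun a b hab => LinearMap.ext fun m => Subtype.ext (LinearMap.congr_fun hab m)
    obtain ⟨n', f', hf'⟩ := exists_addApproximation (R := R) (M := M) (X := LinearMap.ker f)
    exact .cons (inAdd_pi n) hf (ih ((hS.hasProjectiveDimensionLT_X₃_iff k hP).1 h) n' f' hf')

end Resolution

/-- construction of the approximation complex. -/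
theorem stmt13 (R : Type u) [CommRing R] [IsNoetherianRing R] [IsDomain R]
    [IsIntegrallyClosed R]
    (hCM : IsCMRing R) (hEq : EquiCodimensional R)
    (d : ℕ) (hd2 : 2 ≤ d) (hd : ringKrullDim R = d)
    (w : Type u) [AddCommGroup w] [Module R w] (hw : IsGlobalCanonicalModule R w)
    (M : Type u) [AddCommGroup M] [Module R M] (hM : IsNCCR R M)
    (N : Type u) [AddCommGroup N] [Module R N] [Module.Finite R N]
    (hN : Module.IsReflexive R N) :
    ∃ (G : ℕ → ModuleCat.{u} R) (g : ∀ i, ↥(G (i + 1)) →ₗ[R] ↥(G i))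
      (g0 : ↥(G 0) →ₗ[R] N),
      (∀ i, i ≤ d - 2 → InAdd R M (G i)) ∧
      (∀ i, d - 2 < i → Subsingleton (G i)) ∧
      (∀ i, (g i) ∘ₗ (g (i + 1)) = 0) ∧ (g0 ∘ₗ g 0 = 0) ∧
      Function.Surjective (fun h : M →ₗ[R] ↥(G 0) => g0 ∘ₗ h) ∧
      Function.Exact (fun h : M →ₗ[R] ↥(G 1) => (g 0) ∘ₗ h)
        (fun h : M →ₗ[R] ↥(G 0) => g0 ∘ₗ h) ∧
      (∀ i, Function.Exact (fun h : M →ₗ[R] ↥(G (i + 2)) => (g (i + 1)) ∘ₗ h)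
        (fun h : M →ₗ[R] ↥(G (i + 1)) => (g i) ∘ₗ h)) ∧
      (∀ i, Module.Projective (Module.End R M)ᵐᵒᵖ (M →ₗ[R] ↥(G i))) := by
  obtain ⟨k, rfl⟩ := Nat.exists_eq_add_of_le' hd2
  obtain ⟨_, _, _, hL⟩ := hM
  have : Module.Finite (Module.End R M)ᵐᵒᵖ (M →ₗ[R] N) := .of_restrictScalars_finite R _ _
  have hpd : HasProjectiveDimensionLT (ModuleCat.of (Module.End R M)ᵐᵒᵖ (M →ₗ[R] N)) (k + 1) := by
    refine hL.hasProjectiveDimensionLT (fun p _ => ?_) _ fun p _ => ?_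
    · rw [IsLocalization.AtPrime.ringKrullDim_eq_height p, hEq.height_eq hd]
      rfl
    · obtain ⟨x, hx, y, hy, hx0, hxy⟩ := exists_regular_pair (p := p) (by
        rw [hEq.height_eq hd]
        exact_mod_cast hd2)
      exact ⟨x, hx, y, hy,
        fun v hv => LinearMap.ext fun m =>
          eq_zero_of_smul_eq_zero_of_isReflexive hx0 (LinearMap.congr_fun hv m),
        fun v w hvw => exists_eq_smul_linearMap_of_isReflexive hx0 hxy hvw⟩
  obtain ⟨G, g, g0, hG, hG', hg, hg0, hsurj, hex, hexact⟩ :=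
    hasAddResolution_of_hasProjectiveDimensionLT hpd
  refine ⟨G, g, g0, hG, hG', hg, hg0, hsurj, hex, hexact, fun i => InAdd.projective_hom ?_⟩
  obtain hi | hi := le_or_gt i k
  · exact hG i hi
  · have := hG' i hi
    exact inAdd_of_subsingleton
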